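/- Let x ∈ AF_2 and y_1, y_2 be two distinct 1-conjugates of x. Then the lines ℓ(x, y_1) and ℓ(x, y_2) intersect in at most one vertex. -/

import Mathlib

open Subgroup

abbrev F2 := FreeGroup (Fin 2)

def IsBasis (x y : F2) : Prop :=
  Function.Bijective (FreeGroup.lift ![x, y] : FreeGroup (Fin 2) →* F2)

/-- `y` is a 1-conjugate of `x`. -/
def CRel (x y : F2) : Prop :=
  ∃ z : F2, IsBasis x z ∧ zpowers y = zpowers (z⁻¹ * x * z)

open FreeGroup in
lemma core_ping (f : F2 →* F2) (u : List (Fin 2 × Bool)) (C : Bool → List (Fin 2 × Bool))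
    (h0 : ∀ e, f (mk [(0, e)]) = mk [(0, e)])
    (h1 : ∀ e, f (mk [(1, e)]) = mk (u ++ C e ++ invRev u))
    (hr : ∀ e, IsReduced (u ++ C e ++ invRev u))
    (hcc : ∀ e, IsReduced (C e ++ C e)) (hne : ∀ e, C e ≠ [])
    (hh : ∀ e, ∀ q ∈ (u ++ C e ++ invRev u).head?, q.1 = 1)
    (hl : ∀ e, ∀ q ∈ (u ++ C e ++ invRev u).getLast?, q.1 = 1) :
    ∀ (L : List (Fin 2 × Bool)) (i : Fin 2) (e : Bool), IsReduced ((i, e) :: L) →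
      (i = 0 → ∃ r, IsReduced ((0, e) :: r) ∧ f (mk ((i, e) :: L)) = mk ((0, e) :: r)) ∧
      (i = 1 → ∃ r, IsReduced (u ++ C e ++ r) ∧ f (mk ((i, e) :: L)) = mk (u ++ C e ++ r)) := by
  intro L
  induction L with
  | nil =>
    intro i e _
    refine ⟨?_, ?_⟩
    · rintro rfl
      exact ⟨[], IsReduced.singleton, h0 e⟩
    · rintro rfl
      exact ⟨_, hr e, h1 e⟩
  | cons p L ih =>
    obtain ⟨j, d⟩ := p
    intro i e hred
    rw [isReduced_cons_cons] at hred
    obtain ⟨hij, hred⟩ := hred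
    simp only at hij
    have hmul : f (mk ((i, e) :: (j, d) :: L)) = f (mk [(i, e)]) * f (mk ((j, d) :: L)) := by
      rw [← _root_.map_mul, mul_mk]; rfl
    have hd : ∀ r q, q ∈ (u ++ C d ++ r).head? → q.1 = 1 := by
      intro r q hq
      apply hh d q
      have hn := hne d
      have : u ++ C d ≠ [] := by simp [hn]
      rw [List.head?_append_of_ne_nil _ this] at hq ⊢
      exact hq
    obtain ⟨iha, ihb⟩ := ih j d hred
    rw [hmul]
    have hj : j = 0 ∨ j = 1 := by omega
    refine ⟨?_, ?_⟩
    · rintro rfl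
      rcases hj with rfl | rfl
      · obtain ⟨r, hr1, hr2⟩ := iha rfl
        refine ⟨(0, d) :: r, ?_, ?_⟩
        · rw [isReduced_cons_cons]; exact ⟨hij, hr1⟩
        · rw [h0, hr2, mul_mk]; rfl
      · obtain ⟨r, hr1, hr2⟩ := ihb rfl
        refine ⟨u ++ C d ++ r, ?_, ?_⟩
        · unfold FreeGroup.IsReduced
          rw [List.isChain_cons]
          refine ⟨?_, hr1⟩
          intro y hy h
          have := hd r y hy
          simp [this] at h
        · rw [h0, hr2, mul_mk]; rfl
    · rintro rfl
      rcases hj with rfl | rfl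
      · obtain ⟨r, hr1, hr2⟩ := iha rfl
        refine ⟨invRev u ++ (0, d) :: r, ?_, ?_⟩
        · rw [← List.append_assoc]
          unfold FreeGroup.IsReduced
          rw [List.isChain_append]
          refine ⟨hr e, hr1, ?_⟩
          intro x hx y hy h
          have := hl e x hx
          simp only [List.head?_cons, Option.mem_def, Option.some.injEq] at hy
          subst hy
          simp [this] at h
        · rw [h1, hr2, mul_mk]; simp
      · obtain ⟨r, hr1, hr2⟩ := ihb rfl
        have : e = d := hij rfl
        subst this
        refine ⟨C e ++ r, ?_, ?_⟩
        · have a1 : IsReduced (u ++ C e) := (hr e).infix ⟨[], invRev u, by simp⟩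
          have a2 : IsReduced (u ++ C e ++ C e) := a1.append_overlap (hcc e) (hne e)
          have a3 : IsReduced (C e ++ r) := hr1.infix ⟨u, [], by simp⟩
          simpa using a2.append_overlap a3 (hne e)
        · rw [h1, hr2]
          simp only [← mul_mk, ← inv_mk]
          group

open FreeGroup in
lemma isReduced_invRev {L : List (Fin 2 × Bool)} (h : IsReduced L) : IsReduced (invRev L) := by
  rw [isReduced_iff_reduce_eq] at *
  rw [reduce_invRev, h]

/-- The word of `s` is empty or starts and ends with a letter of the second generator. -/
def Trim (s : F2) : Prop :=
  (∀ q ∈ s.toWord.head?, q.1 = 1) ∧ (∀ q ∈ s.toWord.getLast?, q.1 = 1)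

open FreeGroup in
lemma Trim.inv {s : F2} (h : Trim s) : Trim s⁻¹ := by
  obtain ⟨h1, h2⟩ := h
  unfold Trim
  rw [toWord_inv]
  unfold invRev
  simp only [List.head?_reverse, List.getLast?_reverse, List.head?_map, List.getLast?_map]
  constructor
  · intro q hq
    simp only [Option.mem_def, Option.map_eq_some_iff] at hq
    obtain ⟨a, ha, rfl⟩ := hq
    exact h2 a ha
  · intro q hq
    simp only [Option.mem_def, Option.map_eq_some_iff] at hq
    obtain ⟨a, ha, rfl⟩ := hq
    exact h1 a ha

open FreeGroup in
lemma mk_zero (e : Bool) : ∃ k : ℤ, (mk [((0 : Fin 2), e)] : F2) = of 0 ^ k := by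
  cases e
  · exact ⟨-1, by rw [zpow_neg_one]; rfl⟩
  · exact ⟨1, by rw [zpow_one]; rfl⟩

open FreeGroup in
lemma exists_trim (n : ℕ) : ∀ t : F2, t.norm ≤ n →
    ∃ (i j : ℤ) (s : F2), t = of 0 ^ i * s * of 0 ^ j ∧ Trim s := by
  induction n with
  | zero =>
    intro t ht
    have : t = 1 := norm_eq_zero.1 (by omega)
    subst this
    exact ⟨0, 0, 1, by simp, by simp [Trim]⟩
  | succ n ih =>
    intro t ht
    by_cases hT : Trim t
    · exact ⟨0, 0, t, by simp, hT⟩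
    unfold Trim at hT
    rw [not_and_or] at hT
    push Not at hT
    rcases hT with ⟨q, hq, hq1⟩ | ⟨q, hq, hq1⟩
    · obtain ⟨i, e⟩ := q
      have hi : i = 0 := by simp only at hq1; omega
      subst hi
      obtain ⟨L, hL⟩ : ∃ L, t.toWord = (0, e) :: L := by
        simp only [Option.mem_def] at hq
        exact ⟨_, (List.head?_eq_some_iff.1 hq).choose_spec⟩
      have htL : t = mk [(0, e)] * mk L := by
        rw [mul_mk, ← mk_toWord (x := t), hL]; rfl
      have hLn : (mk L).norm ≤ n := by
        have := norm_mk_le (L₁ := L)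
        unfold FreeGroup.norm at ht
        rw [hL] at ht
        simp at ht
        omega
      obtain ⟨i, j, s, hs, hT⟩ := ih _ hLn
      obtain ⟨k, hk⟩ := mk_zero e
      refine ⟨k + i, j, s, ?_, hT⟩
      rw [htL, hk, hs, zpow_add]
      group
    · obtain ⟨i, e⟩ := q
      have hi : i = 0 := by simp only at hq1; omega
      subst hi
      obtain ⟨L, hL⟩ : ∃ L, t.toWord = L ++ [(0, e)] := by
        simp only [Option.mem_def] at hq
        exact ⟨_, (List.getLast?_eq_some_iff.1 hq).choose_spec⟩
      have htL : t = mk L * mk [(0, e)] := by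
        rw [mul_mk, ← mk_toWord (x := t), hL]
      have hLn : (mk L).norm ≤ n := by
        have := norm_mk_le (L₁ := L)
        unfold FreeGroup.norm at ht
        rw [hL] at ht
        simp at ht
        omega
      obtain ⟨i, j, s, hs, hT⟩ := ih _ hLn
      obtain ⟨k, hk⟩ := mk_zero e
      refine ⟨i, j + k, s, ?_, hT⟩
      rw [htL, hk, hs, zpow_add]
      group

/-- Exponent sum homomorphism. -/
def expo (m n : ℤ) : F2 →* Multiplicative ℤ :=
  FreeGroup.lift ![Multiplicative.ofAdd m, Multiplicative.ofAdd n]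

open FreeGroup in
lemma trim_core (s : F2) (hT : Trim s)
    (hs : Function.Surjective (FreeGroup.lift ![of 0, s] : F2 →* F2)) :
    s = of 1 ∨ s = (of 1)⁻¹ := by
  obtain ⟨w, hw⟩ := hs (of 1)
  by_cases hs1 : s = 1
  · subst hs1
    exfalso
    have : (expo 0 1).comp (FreeGroup.lift ![of 0, 1] : F2 →* F2) = 1 := by
      ext i
      fin_cases i <;> simp [expo]
    have h2 := DFunLike.congr_fun this w
    rw [MonoidHom.comp_apply, hw] at h2
    simp [expo] at h2
  set u := reduceCyclically.conjugator s.toWord with hu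
  set c := reduceCyclically s.toWord with hc
  have hW : u ++ c ++ invRev u = s.toWord :=
    reduceCyclically.conj_conjugator_reduceCyclically s.toWord
  have hcr : IsCyclicallyReduced c := reduceCyclically.isCyclicallyReduced isReduced_toWord
  have hcne : c ≠ [] := by
    intro h
    apply hs1
    rw [← mk_toWord (x := s), ← hW, h]
    simp only [← mul_mk, ← inv_mk]
    rw [← one_eq_mk]; group
  have hcc : IsReduced (c ++ c) := by
    have := (hcr.flatten_replicate 2).isReduced
    simpa [List.replicate] using this
  have hWi : u ++ invRev c ++ invRev u = s⁻¹.toWord := by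
    rw [toWord_inv, ← hW]; simp [invRev_append]
  have hTi := hT.inv
  set C : Bool → List (Fin 2 × Bool) := fun e => if e then c else invRev c with hC
  have hCt : C true = c := rfl
  have hCf : C false = invRev c := rfl
  have key := core_ping (FreeGroup.lift ![of 0, s]) u C
    (by intro e; cases e <;> simp [of, inv_mk, invRev])
    (by
      intro e; cases e
      · rw [hCf, hWi, mk_toWord]; simp
      · rw [hCt, hW, mk_toWord]; simp)
    (by
      intro e; cases e
      · rw [hCf, hWi]; exact isReduced_toWord
      · rw [hCt, hW]; exact isReduced_toWord)
    (by
      intro e; cases e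
      · rw [hCf, ← invRev_append]; exact isReduced_invRev hcc
      · exact hcc)
    (by
      intro e; cases e
      · rw [hCf]; intro h; apply hcne
        rw [← invRev_invRev (L₁ := c), h]; rfl
      · exact hcne)
    (by
      intro e; cases e
      · rw [hCf, hWi]; exact hTi.1
      · rw [hCt, hW]; exact hT.1)
    (by
      intro e; cases e
      · rw [hCf, hWi]; exact hTi.2
      · rw [hCt, hW]; exact hT.2)
  rcases hwL : w.toWord with _ | ⟨⟨i, e⟩, L⟩
  · exfalso
    rw [toWord_eq_nil_iff] at hwL
    subst hwL
    rw [_root_.map_one] at hw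
    exact one_ne_of _ hw
  have hwr : IsReduced ((i, e) :: L) := by rw [← hwL]; exact isReduced_toWord
  have hwm : mk ((i, e) :: L) = w := by rw [← hwL, mk_toWord]
  obtain ⟨k1, k2⟩ := key L i e hwr
  rw [hwm, hw] at k1 k2
  have hi : i = 0 ∨ i = 1 := by omega
  rcases hi with h | h
  · exfalso
    obtain ⟨r, hr1, hr2⟩ := k1 h
    have := congrArg toWord hr2
    rw [toWord_of, toWord_mk, hr1.reduce_eq] at this
    simp at this
  · obtain ⟨r, hr1, hr2⟩ := k2 h
    have := congrArg toWord hr2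
    rw [toWord_of, toWord_mk, hr1.reduce_eq] at this
    have hlen := congrArg List.length this
    have hclen : 0 < c.length := List.length_pos_iff.2 hcne
    have hCl : (C e).length = c.length := by cases e <;> simp [hC]
    simp only [List.length_append, List.length_singleton, hCl] at hlen
    have hu0 : u = [] := List.length_eq_zero_iff.1 (by omega)
    have hr0 : r = [] := List.length_eq_zero_iff.1 (by omega)
    rw [hu0, hr0] at this
    simp only [List.nil_append, List.append_nil] at this
    cases e
    · right
      rw [hu0, ← this.trans hCf] at hWi
      rw [← inv_eq_iff_eq_inv, ← mk_toWord (x := s⁻¹), ← hWi]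
      simp [of]
    · left
      rw [hu0] at hW
      rw [← mk_toWord (x := s), ← hW, ← hCt, ← this]
      simp [of]

open FreeGroup in
lemma centralizer_gen (g : F2) (h : g * of 0 = of 0 * g) : ∃ k : ℤ, g = of 0 ^ k := by
  obtain ⟨i, j, s, rfl, hT⟩ := exists_trim _ g le_rfl
  have hs : s = of 0 * s * (of 0)⁻¹ := by
    have e1 : of 0 ^ i * (s * of 0) * of 0 ^ j = of 0 ^ i * (of 0 * s) * of 0 ^ j := by
      calc _ = of 0 ^ i * s * of 0 ^ j * of 0 := by group
        _ = _ := h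
        _ = _ := by group
    have e2 := mul_left_cancel (mul_right_cancel e1)
    rw [← e2]; group
  rcases hw : s.toWord with _ | ⟨p, L⟩
  · rw [toWord_eq_nil_iff] at hw
    subst hw
    exact ⟨i + j, by rw [zpow_add]; group⟩
  exfalso
  have hred : IsReduced (((0, true) :: s.toWord) ++ [((0 : Fin 2), false)]) := by
    unfold FreeGroup.IsReduced
    rw [List.isChain_append]
    refine ⟨?_, List.isChain_singleton _, ?_⟩
    · rw [List.isChain_cons]
      refine ⟨?_, isReduced_toWord⟩
      intro y hy hh
      have := hT.1 y hy
      simp [this] at hh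
    · intro x hx y hy hh
      rw [List.getLast?_cons_of_ne_nil (by simp [hw])] at hx
      have := hT.2 x hx
      simp at hy
      subst hy
      simp [this] at hh
  have h2 : s = mk (((0, true) :: s.toWord) ++ [((0 : Fin 2), false)]) := by
    conv_lhs => rw [hs, ← mk_toWord (x := s)]
    simp [of, inv_mk, invRev]
  have h3 := congrArg toWord h2
  rw [toWord_mk, hred.reduce_eq] at h3
  have := congrArg List.length h3
  simp at this
  omega

open FreeGroup in
lemma IsBasis.swap {x t : F2} (h : IsBasis x t) : IsBasis t x := by
  unfold IsBasis at *
  have : (FreeGroup.lift ![t, x] : F2 →* F2) =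
      (FreeGroup.lift ![x, t] : F2 →* F2).comp
        (freeGroupCongr (Equiv.swap (0 : Fin 2) 1)).toMonoidHom := by
    ext i
    fin_cases i <;> simp
  rw [this]
  exact h.comp (freeGroupCongr (Equiv.swap (0 : Fin 2) 1)).bijective

open FreeGroup in
lemma exists_expo {x t : F2} (h : IsBasis x t) (m n : ℤ) :
    ∃ e : F2 →* Multiplicative ℤ, e x = Multiplicative.ofAdd m ∧ e t = Multiplicative.ofAdd n := by
  let φ := MulEquiv.ofBijective _ h
  have h0 : φ (of 0) = x := (FreeGroup.lift_apply_of).trans rfl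
  have h1 : φ (of 1) = t := (FreeGroup.lift_apply_of).trans rfl
  refine ⟨(expo m n).comp φ.symm.toMonoidHom, ?_, ?_⟩
  · rw [← h0]; simp [expo]
  · rw [← h1]; simp [expo]

open FreeGroup in
lemma centralizer_basis {x t : F2} (h : IsBasis x t) {g : F2} (hg : g * x = x * g) :
    ∃ k : ℤ, g = x ^ k := by
  let φ := MulEquiv.ofBijective _ h
  have h0 : φ (of 0) = x := (FreeGroup.lift_apply_of).trans rfl
  obtain ⟨g, rfl⟩ := φ.surjective g
  rw [← h0, ← _root_.map_mul, ← _root_.map_mul] at hg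
  obtain ⟨k, hk⟩ := centralizer_gen g (φ.injective hg)
  exact ⟨k, by rw [← h0, ← map_zpow, hk]⟩

lemma zpow_comm_zero {x t : F2} (h : IsBasis x t) {k : ℤ} (hk : x ^ k * t = t * x ^ k) :
    k = 0 := by
  obtain ⟨l, hl⟩ := centralizer_basis h.swap hk
  obtain ⟨e, ex, et⟩ := exists_expo h 1 0
  have := congrArg e hl
  rw [map_zpow, map_zpow, ex, et] at this
  have := congrArg Multiplicative.toAdd this
  simpa using this

open FreeGroup in
lemma basis_form {x z t : F2} (hz : IsBasis x z) (ht : IsBasis x t) :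
    ∃ i j : ℤ, t = x ^ i * z * x ^ j ∨ t = x ^ i * z⁻¹ * x ^ j := by
  let φ := MulEquiv.ofBijective _ hz
  have h0 : φ (of 0) = x := (FreeGroup.lift_apply_of).trans rfl
  have h1 : φ (of 1) = z := (FreeGroup.lift_apply_of).trans rfl
  obtain ⟨t, rfl⟩ := φ.surjective t
  obtain ⟨i, j, s, rfl, hT⟩ := exists_trim _ t le_rfl
  have hφ : φ (of 0 ^ i * s * of 0 ^ j) = x ^ i * φ s * x ^ j := by simp [h0]
  rw [hφ] at ht ⊢
  have hsurj : Function.Surjective (FreeGroup.lift ![of 0, s] : F2 →* F2) := by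
    have h2 := ht.2
    rw [lift_surjective_iff_closure_range_eq_top] at h2
    rw [← MonoidHom.range_eq_top]
    have h3 : (⊤ : Subgroup F2) ≤
        (φ.toMonoidHom.comp (FreeGroup.lift ![of 0, s] : F2 →* F2)).range := by
      rw [← h2, Subgroup.closure_le]
      have hx : x ∈ (φ.toMonoidHom.comp (FreeGroup.lift ![of 0, s] : F2 →* F2)).range :=
        ⟨of 0, by simpa using h0⟩
      have hs : φ s ∈ (φ.toMonoidHom.comp (FreeGroup.lift ![of 0, s] : F2 →* F2)).range :=
        ⟨of 1, by simp⟩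
      rintro _ ⟨a, rfl⟩
      fin_cases a
      · exact hx
      · exact mul_mem (mul_mem (zpow_mem hx i) hs) (zpow_mem hx j)
    rw [eq_top_iff]
    intro g _
    obtain ⟨w, hw⟩ := h3 (Subgroup.mem_top (φ g))
    exact ⟨w, φ.injective hw⟩
  refine ⟨i, j, ?_⟩
  rcases trim_core s hT hsurj with rfl | rfl
  · left; rw [h1]
  · right; rw [_root_.map_inv, h1]

lemma zpowers_cases {y w : F2} (h : zpowers y = zpowers w) (e : F2 →* Multiplicative ℤ)
    (he : e w = Multiplicative.ofAdd 1) : w = y ∨ w = y⁻¹ := by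
  have h1 : w ∈ zpowers y := h ▸ mem_zpowers w
  have h2 : y ∈ zpowers w := h ▸ mem_zpowers y
  obtain ⟨k, hk⟩ := mem_zpowers_iff.1 h1
  obtain ⟨l, hl⟩ := mem_zpowers_iff.1 h2
  have h3 : e w = (e w ^ l) ^ k := by rw [← map_zpow, hl, ← map_zpow, hk]
  rw [he] at h3
  have h4 := congrArg Multiplicative.toAdd h3
  simp at h4
  rcases Int.isUnit_iff.1 (IsUnit.of_mul_eq_one (a := k) l (by linarith)) with rfl | rfl
  · left; rw [← hk, zpow_one]
  · right; rw [← hk, zpow_neg_one]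

lemma conj_eq {x t g h : F2} (hb : IsBasis x t)
    (hz : zpowers (g⁻¹ * x * g) = zpowers (h⁻¹ * x * h)) : ∃ k : ℤ, h * g⁻¹ = x ^ k := by
  obtain ⟨e, ex, et⟩ := exists_expo hb 1 0
  apply centralizer_basis hb
  rcases zpowers_cases hz e (by simp [ex]) with h1 | h1
  · calc h * g⁻¹ * x = h * (g⁻¹ * x * g) * g⁻¹ := by group
      _ = h * (h⁻¹ * x * h) * g⁻¹ := by rw [h1]
      _ = _ := by group
  · exfalso
    have := congrArg e h1
    simp [ex] at this
    have := congrArg Multiplicative.toAdd this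
    simp at this

lemma line_form {x y t : F2} (hx : IsBasis x t) (hy : IsBasis y t) (hc : CRel x y) :
    zpowers y = zpowers (t⁻¹ * x * t) ∨ zpowers y = zpowers (t * x * t⁻¹) := by
  obtain ⟨z, hz, hyz⟩ := hc
  rw [hyz]
  obtain ⟨e, ex, et⟩ := exists_expo hx 1 0
  obtain ⟨d, dx, dt⟩ := exists_expo hx 0 1
  have hw : ∃ p q : ℤ, z⁻¹ * x * z = t ^ p * x * t ^ q := by
    obtain ⟨p, q, hpq⟩ := basis_form hx.swap hy.swap
    have hno : ∀ p q : ℤ, z⁻¹ * x * z ≠ t ^ p * x⁻¹ * t ^ q := by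
      intro p q h
      have := congrArg e h
      simp [ex, et] at this
      have := congrArg Multiplicative.toAdd this
      simp at this
    rcases zpowers_cases hyz e (by simp [ex]) with h1 | h1
    · rcases hpq with h | h
      · exact ⟨p, q, by rw [h1, h]⟩
      · exact absurd (h1.trans h) (hno _ _)
    · rcases hpq with h | h
      · refine absurd ?_ (hno (-q) (-p))
        rw [h1, h]; group
      · refine ⟨-q, -p, ?_⟩
        rw [h1, h]; group
  obtain ⟨p, q, hpq⟩ := hw
  have hq : q = -p := by
    have := congrArg d hpq
    simp [dx, dt] at this
    have := congrArg Multiplicative.toAdd this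
    simp at this
    omega
  subst hq
  obtain ⟨c, hc⟩ : ∃ c : ℤ, z * t ^ p = x ^ c := by
    apply centralizer_basis hx
    calc z * t ^ p * x = z * (t ^ p * x * t ^ (-p)) * t ^ p := by group
      _ = z * (z⁻¹ * x * z) * t ^ p := by rw [hpq]
      _ = _ := by group
  have main : ∀ (a b ε : ℤ), z = x ^ a * t ^ ε * x ^ b → (ε = 1 ∨ ε = -1) →
      z = x ^ a * t ^ ε := by
    intro a b ε hzz hε
    rw [hzz] at hc
    have hp : p = -ε := by
      have := congrArg d hc
      simp [dx, dt] at this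
      have := congrArg Multiplicative.toAdd this
      simp at this
      omega
    have hcb : c = a + b := by
      have := congrArg e hc
      simp [ex, et] at this
      have := congrArg Multiplicative.toAdd this
      simp at this
      omega
    subst hp hcb
    have h1 : t ^ ε * x ^ b = x ^ b * t ^ ε := by
      calc t ^ ε * x ^ b = x ^ (-a) * (x ^ a * t ^ ε * x ^ b * t ^ (-ε)) * t ^ ε := by group
        _ = x ^ (-a) * x ^ (a + b) * t ^ ε := by rw [hc]
        _ = _ := by group
    have h2 : Commute (x ^ b) t := by
      have h3 : Commute (x ^ b) (t ^ ε) := h1.symm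
      rcases hε with rfl | rfl
      · simpa using h3
      · simpa using h3
    have hb : b = 0 := zpow_comm_zero hx h2
    rw [hzz, hb]; simp
  obtain ⟨a, b, hab⟩ := basis_form hx hz
  rcases hab with h | h
  · left
    have := main a b 1 (by rw [h, zpow_one]) (Or.inl rfl)
    rw [this]
    congr 1
    group
  · right
    have := main a b (-1) (by rw [h, zpow_neg_one]) (Or.inr rfl)
    rw [this]
    congr 1
    group

/-- If `y₁, y₂` are distinct 1-conjugates of `x`, the lines `ℓ(x, y₁)` and
`ℓ(x, y₂)` intersect in at most one vertex. -/
theorem lines_intersect_in_at_most_one_vertex (x y₁ y₂ : F2)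
    (h₁ : CRel x y₁) (h₂ : CRel x y₂) (hne : zpowers y₁ ≠ zpowers y₂) :
    Set.Subsingleton
      ({T : Subgroup F2 | ∃ t : F2, T = zpowers t ∧ IsBasis x t ∧ IsBasis y₁ t} ∩
       {T : Subgroup F2 | ∃ t : F2, T = zpowers t ∧ IsBasis x t ∧ IsBasis y₂ t}) := by
  -- each vertex of the intersection yields a generator `s` as in `unify`
  have key : ∀ T : Subgroup F2,
      (∃ t : F2, T = zpowers t ∧ IsBasis x t ∧ IsBasis y₁ t) →
      (∃ t : F2, T = zpowers t ∧ IsBasis x t ∧ IsBasis y₂ t) →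
      ∃ s t : F2, T = zpowers s ∧ IsBasis x t ∧ (s = t ∨ s = t⁻¹) ∧
        zpowers y₁ = zpowers (s⁻¹ * x * s) ∧ zpowers y₂ = zpowers (s⁻¹⁻¹ * x * s⁻¹) := by
    rintro T ⟨t, rfl, hx, hy₁⟩ ⟨t', hT, hx', hy₂⟩
    have hb : zpowers y₂ = zpowers (t⁻¹ * x * t) ∨ zpowers y₂ = zpowers (t * x * t⁻¹) := by
      obtain ⟨e, -, et⟩ := exists_expo hx 0 1
      rcases zpowers_cases hT.symm e et with h | h
      · subst h; exact line_form hx' hy₂ h₂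
      · subst h
        rcases line_form hx' hy₂ h₂ with a | a
        · right; rw [inv_inv]; exact a
        · left; rw [inv_inv]; exact a
    rcases line_form hx hy₁ h₁ with a | a <;> rcases hb with b | b
    · exact absurd (a.trans b.symm) hne
    · exact ⟨t, t, rfl, hx, Or.inl rfl, a, by rw [inv_inv]; exact b⟩
    · exact ⟨t⁻¹, t, (zpowers_inv).symm, hx, Or.inr rfl, by rw [inv_inv]; exact a,
        by rw [inv_inv, inv_inv]; exact b⟩
    · exact absurd (a.trans b.symm) hne
  rintro T ⟨hT1, hT2⟩ T' ⟨hT1', hT2'⟩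
  obtain ⟨s, t, rfl, hx, hst, a1, a2⟩ := key T hT1 hT2
  obtain ⟨s', t', rfl, hx', hst', a1', a2'⟩ := key T' hT1' hT2'
  obtain ⟨k, hk⟩ := conj_eq hx (a1.symm.trans a1')
  obtain ⟨l, hl⟩ := conj_eq hx (a2.symm.trans a2')
  rw [inv_inv] at hl
  have e1 : s' = x ^ k * s := by rw [← hk]; group
  have e2 : s' = s * x ^ (-l) := by rw [zpow_neg, ← hl]; group
  obtain ⟨e, ex, et⟩ := exists_expo hx 1 0
  have hkl : -l = k := by
    have := congrArg e (e2.symm.trans e1)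
    have := congrArg Multiplicative.toAdd this
    simp [ex] at this
    omega
  rw [hkl] at e2
  have hcomm : Commute (x ^ k) s := e1.symm.trans e2
  have hcomm' : Commute (x ^ k) t := by
    rcases hst with rfl | rfl
    · exact hcomm
    · simpa using hcomm
  have hk0 : k = 0 := zpow_comm_zero hx hcomm'
  rw [e1, hk0]
  simp
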